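/- Let K be a field of characteristic zero, V a finite-dimensional K-vector space, and B : V → V → K a nondegenerate symmetric bilinear form. Let g : V → V be a linear automorphism preserving B (i.e. B(g x, g y) = B(x, y) for all x, y) and satisfying gⁿ = id for some n ≥ 1. Let V^g := {v ∈ V : g v = v} be the fixed subspace. Then V^g and its B-orthogonal complement (V^g)^⊥ := {v ∈ V : B(w, v) = 0 for all w ∈ V^g} are complementary subspaces: V = V^g ⊕ (V^g)^⊥. -/

import Mathlib

/-- Let `B` be a nondegenerate symmetric bilinear form on a finite-dimensional vector space `V`
over a field of characteristic zero, and let `g` be a linear automorphism preserving `B` with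
`g ^ n = 1` for some `n ≥ 1`. Then the fixed subspace `V^g = ker (g - 1)` and its
`B`-orthogonal complement are complementary subspaces of `V`. -/
theorem stmt_4 (K V : Type*) [Field K] [CharZero K] [AddCommGroup V] [Module K V]
    [FiniteDimensional K V]
    (B : LinearMap.BilinForm K V)
    (hsymm : ∀ x y : V, B x y = B y x) (hnd : ∀ x : V, (∀ y : V, B x y = 0) → x = 0)
    (g : V →ₗ[K] V) (hbij : Function.Bijective g)
    (hB : ∀ x y : V, B (g x) (g y) = B x y)
    (n : ℕ) (hn : 1 ≤ n) (hg : g ^ n = 1) :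
    IsCompl (LinearMap.ker (g - 1)) (B.orthogonal (LinearMap.ker (g - 1))) := by
  rw [LinearMap.BilinForm.isCompl_orthogonal_iff_disjoint
    (fun x y h => (hsymm y x).trans h), Submodule.disjoint_def]
  intro x hx hx_orth
  have hgx : g x = x := by simpa [sub_eq_zero] using hx
  refine hnd x fun y => ?_
  have h_inv : ∀ i : ℕ, B x ((g ^ i) y) = B x y := by
    intro i
    induction i with
    | zero => simp
    | succ i ih => rw [pow_succ', Module.End.mul_apply, ← ih, ← hB x ((g ^ i) y), hgx]
  have h_fixed : (∑ i ∈ Finset.range n, g ^ i) y ∈ LinearMap.ker (g - 1) := by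
    rw [LinearMap.mem_ker, ← Module.End.mul_apply, mul_geom_sum, hg, sub_self,
      LinearMap.zero_apply]
  have h_sum : B ((∑ i ∈ Finset.range n, g ^ i) y) x = 0 :=
    LinearMap.BilinForm.mem_orthogonal_iff.mp hx_orth _ h_fixed
  rw [hsymm, LinearMap.sum_apply, map_sum, Finset.sum_congr rfl fun i _ => h_inv i,
    Finset.sum_const, Finset.card_range, nsmul_eq_mul] at h_sum
  exact (mul_eq_zero.mp h_sum).resolve_left (Nat.cast_ne_zero.mpr (by omega))
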